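/- For the Hahn spin chain with β = α+1, the end-to-end correlation at time t = π equals f_{2m+1,0}(π) = -2i·sin(2πα)·(-1)^m·((α+1)_{m+1}(m+1)_m)/((2α+2)_{2m+1}). -/

import Mathlib

open Finset Matrix

/-- Pochhammer symbol `(a)_k = a(a+1)⋯(a+k-1)`. -/
noncomputable def poch (a : ℝ) (k : ℕ) : ℝ := ∏ i ∈ Finset.range k, (a + i)

/-- The Hahn polynomial `Q_n(x;α,β,m)` as a terminating ₃F₂ series. -/
noncomputable def hahnQ (n : ℕ) (x α β : ℝ) (m : ℕ) : ℝ :=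
  ∑ k ∈ Finset.range (n + 1),
    poch (-(n : ℝ)) k * poch ((n : ℝ) + α + β + 1) k * poch (-x) k /
      ((k.factorial : ℝ) * poch (α + 1) k * poch (-(m : ℝ)) k)

/-- The Hahn weight `w(x;α,β,m) = C(α+x,x) C(m+β-x,m-x)`. -/
noncomputable def hahnW (x : ℕ) (α β : ℝ) (m : ℕ) : ℝ :=
  (poch (α + 1) x / (x.factorial : ℝ)) * (poch (β + 1) (m - x) / ((m - x).factorial : ℝ))

/-- The squared norm `h_n(α,β,m)` of the Hahn polynomials. -/
noncomputable def hahnH (n : ℕ) (α β : ℝ) (m : ℕ) : ℝ :=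
  ((-1 : ℝ) ^ n * poch ((n : ℝ) + α + β + 1) (m + 1) * poch (β + 1) n * (n.factorial : ℝ)) /
    ((2 * (n : ℝ) + α + β + 1) * poch (α + 1) n * poch (-(m : ℝ)) n * (m.factorial : ℝ))

/-- Orthonormal Hahn function `Q̃_n(x;α,β,m)`. -/
noncomputable def hahnQt (n x : ℕ) (α β : ℝ) (m : ℕ) : ℝ :=
  Real.sqrt (hahnW x α β m) * hahnQ n (x : ℝ) α β m / Real.sqrt (hahnH n α β m)

/-- The matrix `U` of eigenvectors, built from Hahn polynomials with
parameters `(α,β)` (even rows) and `(α+1,β-1)` (odd rows). -/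
noncomputable def hahnU (α β : ℝ) (m : ℕ) : Matrix (Fin (2 * m + 2)) (Fin (2 * m + 2)) ℝ :=
  Matrix.of fun r c =>
    let i : ℕ := (r : ℕ) / 2
    let j : ℕ := if (c : ℕ) ≤ m then m - (c : ℕ) else (c : ℕ) - m - 1
    if (r : ℕ) % 2 = 0 then
      ((-1 : ℝ) ^ i / Real.sqrt 2) * hahnQt j i α β m
    else
      (if (c : ℕ) ≤ m then (-1 : ℝ) else 1) * ((-1 : ℝ) ^ i / Real.sqrt 2)
        * hahnQt j i (α + 1) (β - 1) m

/-- The spin chain couplings `J_k`. -/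
noncomputable def hahnJ (α β : ℝ) (m : ℕ) (k : ℕ) : ℝ :=
  if k % 2 = 1 then Real.sqrt (((k : ℝ) + 1) * ((2 * m + 1 : ℝ) - k))
  else Real.sqrt (((k : ℝ) + 2 * α + 2) * ((2 * m : ℝ) + 2 * β - k))

/-- The tridiagonal single-excitation interaction matrix `M`. -/
noncomputable def hahnM (α β : ℝ) (m : ℕ) : Matrix (Fin (2 * m + 2)) (Fin (2 * m + 2)) ℝ :=
  Matrix.of fun r c =>
    if (r : ℕ) + 1 = (c : ℕ) then hahnJ α β m r
    else if (c : ℕ) + 1 = (r : ℕ) then hahnJ α β m c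
    else 0

/-- The eigenvalues `ε_{m-k} = -2√((α+k+1)(β+k))`, `ε_{m+k+1} = 2√((α+k+1)(β+k))`. -/
noncomputable def hahnEps (α β : ℝ) (m : ℕ) (c : Fin (2 * m + 2)) : ℝ :=
  if (c : ℕ) ≤ m then
    -2 * Real.sqrt ((α + (m - (c : ℕ) : ℕ) + 1) * (β + (m - (c : ℕ) : ℕ)))
  else
    2 * Real.sqrt ((α + ((c : ℕ) - m - 1 : ℕ) + 1) * (β + ((c : ℕ) - m - 1 : ℕ)))

/-- The correlation function `f_{r,s}(t)`. -/
noncomputable def hahnCorr (α β : ℝ) (m : ℕ) (r s : Fin (2 * m + 2)) (t : ℝ) : ℂ :=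
  ∑ j : Fin (2 * m + 2),
    ((hahnU α β m r j * hahnU α β m s j : ℝ) : ℂ)
      * Complex.exp (-Complex.I * t * (hahnEps α β m j : ℝ))

lemma poch_zero' (a : ℝ) : poch a 0 = 1 := by simp [poch]

lemma poch_succ' (a : ℝ) (k : ℕ) : poch a (k + 1) = poch a k * (a + k) := by
  simp [poch, Finset.prod_range_succ]

lemma poch_succ_left' (a : ℝ) (k : ℕ) : poch a (k + 1) = a * poch (a + 1) k := by
  unfold poch
  rw [Finset.prod_range_succ', mul_comm]
  congr 1
  · simp
  · apply Finset.prod_congr rfl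
    intro i _
    push_cast
    ring

lemma poch_pos' {a : ℝ} (ha : 0 < a) (k : ℕ) : 0 < poch a k := by
  unfold poch
  exact Finset.prod_pos fun i _ => by positivity

lemma poch_neg_nat (n k : ℕ) (hk : k ≤ n) :
    poch (-(n : ℝ)) k = (-1) ^ k * (n.descFactorial k : ℝ) := by
  induction k with
  | zero => simp [poch]
  | succ k ih =>
    rw [poch_succ', ih (by omega), Nat.descFactorial_succ, Nat.cast_mul, Nat.cast_sub (by omega)]
    ring

lemma desc_eq (n k : ℕ) : (n.descFactorial k : ℝ) = (k.factorial : ℝ) * (n.choose k : ℝ) := by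
  exact_mod_cast Nat.descFactorial_eq_factorial_mul_choose n k

lemma alt_binom_succ (u : ℕ → ℝ) (j : ℕ) :
    ∑ k ∈ Finset.range (j + 2), (-1 : ℝ) ^ k * ((j + 1).choose k : ℝ) * u k
      = ∑ k ∈ Finset.range (j + 1), (-1 : ℝ) ^ k * (j.choose k : ℝ) * (u k - u (k + 1)) := by
  have h1 : ∑ k ∈ Finset.range (j + 1), (-1 : ℝ) ^ k * (j.choose k : ℝ) * u k
      = ∑ k ∈ Finset.range (j + 1), (-1 : ℝ) ^ (k + 1) * (j.choose (k + 1) : ℝ) * u (k + 1)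
        + u 0 := by
    have := Finset.sum_range_succ (fun k => (-1 : ℝ) ^ k * (j.choose k : ℝ) * u k) (j + 1)
    rw [Finset.sum_range_succ'] at this
    simp at this
    simpa using this.symm
  simp_rw [mul_sub]
  rw [Finset.sum_sub_distrib, h1, Finset.sum_range_succ']
  have h2 : ∀ k, (-1 : ℝ) ^ (k + 1) * ((j + 1).choose (k + 1) : ℝ) * u (k + 1)
      = (-1 : ℝ) ^ (k + 1) * (j.choose (k + 1) : ℝ) * u (k + 1)
        - (-1 : ℝ) ^ k * (j.choose k : ℝ) * u (k + 1) := by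
    intro k
    rw [Nat.choose_succ_succ]
    push_cast
    ring
  simp_rw [h2]
  rw [Finset.sum_sub_distrib]
  simp
  ring

lemma chu_vdm (j : ℕ) (b c : ℝ) (hc : 0 < c) :
    ∑ k ∈ Finset.range (j + 1), (-1 : ℝ) ^ k * (j.choose k : ℝ) * (poch b k / poch c k)
      = poch (c - b) j / poch c j := by
  induction j generalizing c with
  | zero => simp [poch]
  | succ j ih =>
    rw [alt_binom_succ (fun k => poch b k / poch c k)]
    have h : ∀ k, poch b k / poch c k - poch b (k + 1) / poch c (k + 1)
        = (c - b) / c * (poch b k / poch (c + 1) k) := by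
      intro k
      have e : poch c k * (c + k) = c * poch (c + 1) k := by
        rw [← poch_succ', poch_succ_left']
      have p1 := (poch_pos' hc k).ne'
      have p2 := (poch_pos' (show 0 < c + 1 by linarith) k).ne'
      have p3 : c + (k : ℝ) ≠ 0 := by positivity
      have e2 : poch (c + 1) k = poch c k * (c + k) / c := by
        rw [e]; field_simp
      rw [e2, poch_succ', poch_succ']
      field_simp
      ring
    simp_rw [h]
    have := ih (c + 1) (by linarith)
    rw [poch_succ_left' (c - b), poch_succ_left' c, show c - b + 1 = c + 1 - b by ring,
      mul_div_mul_comm, ← this, Finset.mul_sum]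
    apply Finset.sum_congr rfl
    intro k _
    ring

lemma diff_sum (m n : ℕ) (a : ℝ) (ha : 0 < a) :
    ∑ j ∈ Finset.range (m + 1), (-1 : ℝ) ^ j * (m.choose j : ℝ) * (1 / poch (a + j) (n + 1))
      = poch ((n : ℝ) + 1) m / poch a (n + m + 1) := by
  induction m generalizing n with
  | zero => simp [poch]
  | succ m ih =>
    rw [alt_binom_succ (fun k => 1 / poch (a + k) (n + 1))]
    have h : ∀ k : ℕ, 1 / poch (a + k) (n + 1) - 1 / poch (a + (k + 1 : ℕ)) (n + 1)
        = ((n : ℝ) + 1) * (1 / poch (a + k) (n + 1 + 1)) := by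
      intro k
      have hk : 0 < a + (k : ℝ) := by positivity
      have q := (poch_pos' (show 0 < a + (k : ℝ) + 1 by linarith) n).ne'
      have hk3 : a + (k : ℝ) + 1 + n ≠ 0 := by positivity
      rw [show a + ((k + 1 : ℕ) : ℝ) = a + k + 1 by push_cast; ring,
        poch_succ_left' (a + k) (n + 1), poch_succ_left' (a + k) n, poch_succ' (a + k + 1)]
      field_simp
      ring
    simp_rw [h]
    have := ih (n + 1)
    rw [poch_succ_left', show n + (m + 1) + 1 = n + 1 + m + 1 by ring, mul_div_assoc]
    push_cast at this
    rw [← this, Finset.mul_sum]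
    apply Finset.sum_congr rfl
    intro k _
    ring

lemma poch_reflect (α : ℝ) (j : ℕ) : poch (-α - j) j = (-1) ^ j * poch (α + 1) j := by
  induction j with
  | zero => simp [poch]
  | succ j ih =>
    rw [poch_succ_left', poch_succ', show -α - ((j + 1 : ℕ) : ℝ) + 1 = -α - j by push_cast; ring, ih]
    push_cast
    ring

lemma hahnQ_zero (n : ℕ) (α β : ℝ) (m : ℕ) : hahnQ n ((0 : ℕ) : ℝ) α β m = 1 := by
  unfold hahnQ
  rw [Finset.sum_eq_single 0]
  · simp [poch]
  · intro k _ hk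
    obtain ⟨k, rfl⟩ := Nat.exists_eq_succ_of_ne_zero hk
    simp [poch_succ_left']
  · simp

lemma hahnQ_end (j m : ℕ) (hj : j ≤ m) (α : ℝ) (hα : α > -1) :
    hahnQ j (m : ℝ) (α + 1) α m = (-1) ^ j * poch (α + 1) j / poch (α + 2) j := by
  have h := chu_vdm j ((j : ℝ) + (α + 1) + α + 1) (α + 2) (by linarith)
  rw [show α + 2 - ((j : ℝ) + (α + 1) + α + 1) = -α - j by ring, poch_reflect] at h
  rw [← h]
  unfold hahnQ
  apply Finset.sum_congr rfl
  intro k hk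
  have hk : k ≤ j := by simp at hk; omega
  rw [poch_neg_nat j k hk, poch_neg_nat m k (by omega), desc_eq, desc_eq,
    show α + 1 + 1 = α + 2 by ring]
  have p1 := (poch_pos' (show 0 < α + 2 by linarith) k).ne'
  have p2 : (k.factorial : ℝ) ≠ 0 := by positivity
  have p3 : (m.choose k : ℝ) ≠ 0 := by
    have := Nat.choose_pos (show k ≤ m by omega)
    positivity
  field_simp

lemma prod_Qt (j m : ℕ) (hj : j ≤ m) (α : ℝ) (hα : α > -1) :
    hahnQt j m (α + 1) (α + 1 - 1) m * hahnQt j 0 α (α + 1) m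
      = 2 * poch (α + 1) (m + 1) *
        ((-1 : ℝ) ^ j * (m.choose j : ℝ) * (1 / poch (2 * α + 2 + j) (m + 1))) := by
  have a1 : 0 < α + 1 := by linarith
  have p1 := poch_pos' a1 j
  have p2 := poch_pos' (show 0 < α + 2 by linarith) j
  have p2m := poch_pos' (show 0 < α + 2 by linarith) m
  have p3 := poch_pos' (show 0 < 2 * α + 2 + (j : ℝ) by
    have : (0 : ℝ) ≤ j := by positivity
    linarith) (m + 1)
  have p4 : (0 : ℝ) < m.choose j := by exact_mod_cast Nat.choose_pos hj
  have p5 : (0 : ℝ) < j.factorial := by positivity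
  have p6 : (0 : ℝ) < m.factorial := by positivity
  have p7 : 0 < α + 1 + (j : ℝ) := by positivity
  have e : poch (α + 1) j * (α + 1 + j) = (α + 1) * poch (α + 2) j := by
    rw [← poch_succ', poch_succ_left', show α + 1 + 1 = α + 2 by ring]
  set A := poch (2 * α + 2 + (j : ℝ)) (m + 1) with hA
  set D : ℝ := A / (2 * (α + 1 + j) * m.choose j * m.factorial) with hD
  have hDpos : 0 < D := by positivity
  have sgn : ((-1 : ℝ) ^ j) ≠ 0 := by positivity
  have h1 : hahnH j (α + 1) α m = D * (poch (α + 1) j / poch (α + 2) j) := by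
    unfold hahnH
    rw [poch_neg_nat m j hj, desc_eq, show (j : ℝ) + (α + 1) + α + 1 = 2 * α + 2 + j by ring,
      show 2 * (j : ℝ) + (α + 1) + α + 1 = 2 * (α + 1 + j) by ring,
      show α + 1 + 1 = α + 2 by ring, ← hA, hD]
    field_simp
  have h2 : hahnH j α (α + 1) m = D * (poch (α + 2) j / poch (α + 1) j) := by
    unfold hahnH
    rw [poch_neg_nat m j hj, desc_eq, show (j : ℝ) + α + (α + 1) + 1 = 2 * α + 2 + j by ring,
      show 2 * (j : ℝ) + α + (α + 1) + 1 = 2 * (α + 1 + j) by ring,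
      show α + 1 + 1 = α + 2 by ring, ← hA, hD]
    field_simp
  have w1 : hahnW m (α + 1) α m = poch (α + 2) m / m.factorial := by
    simp [hahnW, poch_zero', show α + 1 + 1 = α + 2 by ring]
  have w2 : hahnW 0 α (α + 1) m = poch (α + 2) m / m.factorial := by
    simp [hahnW, poch_zero', show α + 1 + 1 = α + 2 by ring]
  have hs : Real.sqrt (hahnH j (α + 1) α m) * Real.sqrt (hahnH j α (α + 1) m) = D := by
    rw [← Real.sqrt_mul (by rw [h1]; positivity), h1, h2]
    rw [show D * (poch (α + 1) j / poch (α + 2) j) * (D * (poch (α + 2) j / poch (α + 1) j))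
      = D ^ 2 by field_simp]
    exact Real.sqrt_sq hDpos.le
  have hw : Real.sqrt (poch (α + 2) m / m.factorial) * Real.sqrt (poch (α + 2) m / m.factorial)
      = poch (α + 2) m / m.factorial := Real.mul_self_sqrt (by positivity)
  rw [show α + 1 - 1 = α by ring]
  unfold hahnQt
  rw [div_mul_div_comm, hs, hahnQ_zero, hahnQ_end j m hj α hα, w1, w2, mul_one, mul_right_comm, hw,
    poch_succ_left', show α + 1 + 1 = α + 2 by ring, hD]
  have e3 : poch (α + 1) j = (α + 1) * poch (α + 2) j / (α + 1 + j) := by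
    rw [← e]; field_simp
  rw [e3]
  field_simp

lemma corr_split (m : ℕ) (F : ℕ → ℂ) :
    ∑ j : Fin (2 * m + 2), F j
      = ∑ k ∈ Finset.range (m + 1), (F (m - k) + F (m + 1 + k)) := by
  rw [Fin.sum_univ_eq_sum_range, show 2 * m + 2 = (m + 1) + (m + 1) by ring, Finset.sum_range_add,
    Finset.sum_add_distrib, ← Finset.sum_range_reflect]
  simp

lemma exp_diff (α : ℝ) (k : ℕ) :
    Complex.exp (-Complex.I * Real.pi * ((2 * (α + k + 1) : ℝ) : ℂ))
      - Complex.exp (-Complex.I * Real.pi * ((-2 * (α + k + 1) : ℝ) : ℂ))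
      = -2 * Complex.I * (Real.sin (2 * Real.pi * α) : ℝ) := by
  have h : Real.sin (2 * Real.pi * α)
      = Real.sin (2 * Real.pi * (α + k + 1)) := by
    rw [show 2 * Real.pi * (α + k + 1) = 2 * Real.pi * α + ((k + 1 : ℕ) : ℝ) * (2 * Real.pi) by
      push_cast; ring, Real.sin_add_nat_mul_two_pi]
  rw [h, Complex.ofReal_sin, Complex.sin]
  rw [show -Complex.I * Real.pi * ((2 * (α + k + 1) : ℝ) : ℂ)
      = -((2 * Real.pi * (α + k + 1) : ℝ) : ℂ) * Complex.I by push_cast; ring,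
    show -Complex.I * Real.pi * ((-2 * (α + k + 1) : ℝ) : ℂ)
      = ((2 * Real.pi * (α + k + 1) : ℝ) : ℂ) * Complex.I by push_cast; ring]
  linear_combination (Complex.exp (-((2 * Real.pi * (α + k + 1) : ℝ) : ℂ) * Complex.I)
    - Complex.exp (((2 * Real.pi * (α + k + 1) : ℝ) : ℂ) * Complex.I)) * Complex.I_mul_I

/-- The summand of the correlation, as a function of a natural number. -/
noncomputable def corrTerm (α : ℝ) (m c : ℕ) : ℂ :=
  (((if c ≤ m then (-1 : ℝ) else 1) * ((-1 : ℝ) ^ m / Real.sqrt 2)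
        * hahnQt (if c ≤ m then m - c else c - m - 1) m (α + 1) (α + 1 - 1) m
      * ((-1 : ℝ) ^ 0 / Real.sqrt 2
        * hahnQt (if c ≤ m then m - c else c - m - 1) 0 α (α + 1) m) : ℝ) : ℂ)
    * Complex.exp (-Complex.I * Real.pi * ((if c ≤ m then
        -2 * Real.sqrt ((α + (m - c : ℕ) + 1) * (α + 1 + (m - c : ℕ)))
      else 2 * Real.sqrt ((α + (c - m - 1 : ℕ) + 1) * (α + 1 + (c - m - 1 : ℕ))) : ℝ) : ℂ))

lemma term_pair (α : ℝ) (hα : α > -1) (m k : ℕ) (hk : k ≤ m) :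
    corrTerm α m (m - k) + corrTerm α m (m + 1 + k)
      = -2 * Complex.I * (Real.sin (2 * Real.pi * α) : ℝ) * (-1 : ℂ) ^ m
        * ((poch (α + 1) (m + 1) *
          ((-1 : ℝ) ^ k * (m.choose k : ℝ) * (1 / poch (2 * α + 2 + k) (m + 1))) : ℝ) : ℂ) := by
  have hs : Real.sqrt ((α + k + 1) * (α + 1 + k)) = α + k + 1 := by
    rw [show α + 1 + (k : ℝ) = α + k + 1 by ring]
    have : (0 : ℝ) ≤ k := by positivity
    exact Real.sqrt_mul_self (by linarith)
  unfold corrTerm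
  rw [if_pos (by omega), if_pos (by omega), if_pos (by omega), if_neg (by omega),
    if_neg (by omega), if_neg (by omega), show m - (m - k) = k by omega,
    show m + 1 + k - m - 1 = k by omega, hs, ← exp_diff α k]
  have hp := prod_Qt k m hk α hα
  have h2 : Real.sqrt 2 * Real.sqrt 2 = 2 := Real.mul_self_sqrt (by norm_num)
  have h2' : Real.sqrt 2 ≠ 0 := by positivity
  have key : ∀ s : ℝ, s * ((-1 : ℝ) ^ m / Real.sqrt 2) * hahnQt k m (α + 1) (α + 1 - 1) m
      * ((-1 : ℝ) ^ 0 / Real.sqrt 2 * hahnQt k 0 α (α + 1) m)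
      = s * ((-1) ^ m * (poch (α + 1) (m + 1) *
          ((-1 : ℝ) ^ k * (m.choose k : ℝ) * (1 / poch (2 * α + 2 + k) (m + 1))))) := by
    intro s
    calc _ = s * (-1) ^ m / (Real.sqrt 2 * Real.sqrt 2) *
          (hahnQt k m (α + 1) (α + 1 - 1) m * hahnQt k 0 α (α + 1) m) := by
            field_simp
      _ = _ := by rw [hp, h2]; ring
  rw [key, key]
  push_cast
  ring

theorem hahn_end_to_end_correlation_at_pi
    (m : ℕ) (α β : ℝ) (hα : α > -1) (hβ : β = α + 1) :
    hahnCorr α β m ⟨2 * m + 1, by omega⟩ ⟨0, by omega⟩ Real.pi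
      = -2 * Complex.I * (Real.sin (2 * Real.pi * α) : ℝ) * (-1 : ℂ) ^ m
          * ((poch (α + 1) (m + 1) * poch ((m : ℝ) + 1) m / poch (2 * α + 2) (2 * m + 1) : ℝ) : ℂ) := by
  subst hβ
  have h : hahnCorr α (α + 1) m ⟨2 * m + 1, by omega⟩ ⟨0, by omega⟩ Real.pi
      = ∑ j : Fin (2 * m + 2), corrTerm α m j := by
    unfold hahnCorr
    apply Finset.sum_congr rfl
    intro j _
    have e1 : (2 * m + 1) / 2 = m := by omega
    have e2 : ¬ (2 * m + 1) % 2 = 0 := by omega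
    simp only [hahnU, hahnEps, corrTerm, Matrix.of_apply, e1, if_neg e2, Nat.zero_div,
      Nat.zero_mod, if_true]
  rw [h, corr_split, mul_div_assoc]
  have hd := diff_sum m m (2 * α + 2) (by linarith)
  rw [show m + m + 1 = 2 * m + 1 by ring] at hd
  rw [← hd, Finset.mul_sum, Complex.ofReal_sum, Finset.mul_sum]
  apply Finset.sum_congr rfl
  intro k hk
  exact term_pair α hα m k (by simp at hk; omega)
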